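/- arXiv:2012.00806 — 3 statements merged into one kernel-verified Lean document; each statement's English description precedes it below -/
import Mathlib

section
/- Let G be a finite simple graph and let b ≥ 1 be a real number. Then every complex root of the one-variable polynomial z ↦ Z_{L(G)}(z, b), the partition function of the Ising model of the line graph L(G), is a negative real number. -/
open Finset

/-- The number of edges of the simple graph `H` with exactly one endpoint in `U`. -/
noncomputable def cutCard {V : Type*} (H : SimpleGraph V) (U : Finset V) : ℕ :=
  Set.ncard {e : Sym2 V | e ∈ H.edgeSet ∧ ∃ u v : V, e = s(u, v) ∧ u ∈ U ∧ v ∉ U}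

/-- The partition function of the Ising model of a finite simple graph `H`:
`Z_H(z, b) = Σ_{U ⊆ V} z^{|U|} b^{|δ(U)|}`. -/
noncomputable def isingZ {V : Type*} [Fintype V] (H : SimpleGraph V) (z b : ℂ) : ℂ :=
  ∑ U : Finset V, z ^ U.card * b ^ cutCard H U

/-- The partition function of the Ising model of the line graph of `G`. -/
noncomputable def isingLineGraph {V : Type*} [Fintype V] (G : SimpleGraph V) (z b : ℂ) : ℂ :=
  letI : Fintype G.edgeSet := Fintype.ofFinite _
  isingZ G.lineGraph z b

open Polynomial in
/-- A complex polynomial of degree at most `n` factors over a family of at most `n` roots. -/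
lemma exists_fin_roots {f : ℂ[X]} {n : ℕ} (hf : f ≠ 0) (hn : f.natDegree ≤ n) :
    ∃ (m : ℕ) (ρ : Fin m → ℂ), m ≤ n ∧ (∀ i, f.eval (ρ i) = 0) ∧
      (∀ x, f.eval x = f.leadingCoeff * ∏ i, (x - ρ i)) ∧
      ∀ x, f.eval x ≠ 0 → (derivative f).eval x = f.eval x * ∑ i, 1 / (x - ρ i) := by
  obtain ⟨l, hl⟩ := Quot.exists_rep f.roots
  replace hl : f.roots = (l : Multiset ℂ) := hl.symm
  refine ⟨l.length, fun i => l[i.1], ?_, fun i => ?_, fun x => ?_, fun x hx => ?_⟩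
  · have := f.card_roots'
    rw [hl, Multiset.coe_card] at this
    exact this.trans hn
  · have : l[i.1] ∈ f.roots := by rw [hl]; simp
    exact (mem_roots hf).1 this
  · rw [(IsAlgClosed.splits f).eval_eq_prod_roots, hl, Fin.prod_univ_fun_getElem l (fun r => x - r)]
    simp
  · have := (IsAlgClosed.splits f).eval_derivative_div_eval_of_ne_zero hx
    rw [hl] at this
    rw [Fin.sum_univ_fun_getElem l (fun r => 1 / (x - r)), ← Multiset.sum_coe,
      ← Multiset.map_coe, ← this]
    field_simp

/-- The squared modulus of a sum is at most the number of terms times the sum of squared moduli. -/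
lemma normSq_sum_le {m : ℕ} (w : Fin m → ℂ) :
    Complex.normSq (∑ i, w i) ≤ m * ∑ i, Complex.normSq (w i) := by
  have h1 := sq_sum_le_card_mul_sum_sq (s := univ) (f := fun i => (w i).re)
  have h2 := sq_sum_le_card_mul_sum_sq (s := univ) (f := fun i => (w i).im)
  simp only [card_univ, Fintype.card_fin] at h1 h2
  simp only [Complex.normSq_apply, Complex.re_sum, Complex.im_sum, sum_add_distrib, mul_add]
  simp only [← sq]
  exact add_le_add h1 h2

open Polynomial in
/-- Laguerre's theorem on polar derivatives, for the closed right half-plane. -/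
lemma polar_derivative_ne_zero {f : ℂ[X]} {n : ℕ} (hn : f.natDegree ≤ n) (hn0 : 0 < n)
    (hf : ∀ x : ℂ, 0 ≤ x.re → f.eval x ≠ 0) {ζ x : ℂ} (hζ : 0 ≤ ζ.re) (hx : 0 ≤ x.re) :
    n * f.eval x + (ζ - x) * (derivative f).eval x ≠ 0 := by
  intro h
  have hfx := hf x hx
  have hf0 : f ≠ 0 := by rintro rfl; simp at hfx
  obtain ⟨m, ρ, hm, hroot, -, hder⟩ := exists_fin_roots hf0 hn
  rw [hder x hfx] at h
  set L := ∑ i, 1 / (x - ρ i) with hL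
  have hnL : (n : ℂ) = (x - ζ) * L := by
    have : f.eval x * (n - (x - ζ) * L) = 0 := by linear_combination h
    exact sub_eq_zero.1 ((mul_eq_zero.1 this).resolve_left hfx)
  have hρ : ∀ i, (ρ i).re < 0 := fun i => by
    by_contra! hc
    exact hf _ hc (hroot i)
  have hterm : ∀ i, x.re * Complex.normSq (1 / (x - ρ i)) < (1 / (x - ρ i)).re := fun i => by
    have hre : 0 < (x - ρ i).re := by rw [Complex.sub_re]; linarith [hρ i]
    have hpos : 0 < Complex.normSq (x - ρ i) :=
      Complex.normSq_pos.2 (by intro h0; rw [h0] at hre; simp at hre)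
    rw [one_div, Complex.normSq_inv, Complex.inv_re, ← div_eq_mul_inv]
    refine div_lt_div_of_pos_right ?_ hpos
    rw [Complex.sub_re]; linarith [hρ i]
  have hne : (univ : Finset (Fin m)).Nonempty := by
    by_contra hc
    rw [not_nonempty_iff_eq_empty] at hc
    rw [hL, hc, sum_empty, mul_zero] at hnL
    exact hn0.ne' (by exact_mod_cast hnL)
  have hsum : x.re * ∑ i, Complex.normSq (1 / (x - ρ i)) < L.re := by
    rw [hL, Complex.re_sum, mul_sum]
    exact sum_lt_sum_of_nonempty hne fun i _ => hterm i
  have hcs := normSq_sum_le fun i => 1 / (x - ρ i)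
  rw [← hL] at hcs
  have hQ : 0 ≤ ∑ i, Complex.normSq (1 / (x - ρ i)) := sum_nonneg fun i _ => Complex.normSq_nonneg _
  have hmn : (m : ℝ) ≤ n := by exact_mod_cast hm
  have hn0' : (0 : ℝ) < n := by exact_mod_cast hn0
  have hre : n * L.re = (x.re - ζ.re) * Complex.normSq L := by
    have h1 := congrArg Complex.re hnL
    have h2 := congrArg Complex.im hnL
    simp only [Complex.natCast_re, Complex.natCast_im, Complex.mul_re, Complex.mul_im,
      Complex.sub_re, Complex.sub_im] at h1 h2
    rw [Complex.normSq_apply]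
    linear_combination L.re * h1 + L.im * h2
  have hLn := Complex.normSq_nonneg L
  have e1 : Complex.normSq L ≤ n * ∑ i, Complex.normSq (1 / (x - ρ i)) :=
    hcs.trans (mul_le_mul_of_nonneg_right hmn hQ)
  have e2 := mul_le_mul_of_nonneg_left e1 hx
  have e3 := mul_lt_mul_of_pos_left hsum hn0'
  have e4 := mul_nonneg hζ hLn
  nlinarith

/-- The complement of the open negative real axis. -/
def nonNegAxis : Set ℂ := {x | x.im = 0 → 0 ≤ x.re}

lemma exists_neg_of_notMem_nonNegAxis {x : ℂ} (hx : x ∉ nonNegAxis) :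
    ∃ r : ℝ, 0 < r ∧ x = -(r : ℂ) := by
  simp only [nonNegAxis, Set.mem_ofPred_eq, Classical.not_imp, not_le] at hx
  exact ⟨-x.re, by linarith [hx.2], by apply Complex.ext <;> simp [hx.1]⟩

lemma exists_fin_neg_roots {m : ℕ} {f : Polynomial ℂ} {ρ : Fin m → ℂ}
    (hf : ∀ x ∈ nonNegAxis, f.eval x ≠ 0) (hρ : ∀ i, f.eval (ρ i) = 0) :
    ∃ r : Fin m → ℝ, (∀ i, 0 < r i) ∧ ∀ i, ρ i = -(r i : ℂ) := by
  choose r hr hr' using fun i => exists_neg_of_notMem_nonNegAxis fun h => hf _ h (hρ i)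
  exact ⟨r, hr, hr'⟩

open Polynomial in
/-- If all roots of `f` are negative and `γ` is not in `[-n, 0]`, then so are those of
`γ f + x f'`. -/
lemma euler_operator_ne_zero {f : ℂ[X]} {n : ℕ} (hn : f.natDegree ≤ n)
    (hf : ∀ x ∈ nonNegAxis, f.eval x ≠ 0) {γ : ℝ} (hγ : 0 < γ ∨ γ < -n) {x : ℂ}
    (hx : x ∈ nonNegAxis) : γ * f.eval x + x * (derivative f).eval x ≠ 0 := by
  intro h
  have hfx := hf x hx
  have hf0 : f ≠ 0 := by rintro rfl; simp at hfx
  obtain ⟨m, ρ, hm, hroot, -, hder⟩ := exists_fin_roots hf0 hn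
  obtain ⟨r, hr, hρ⟩ := exists_fin_neg_roots hf hroot
  rw [hder x hfx] at h
  have hmn : (m : ℝ) ≤ n := by exact_mod_cast hm
  have h0 : (γ : ℂ) + ∑ i, x / (x + r i) = 0 := by
    have : f.eval x * (γ + ∑ i, x / (x + r i)) = 0 := by
      rw [← h]
      simp only [hρ, sub_neg_eq_add, div_eq_mul_inv, one_mul, ← mul_sum]
      ring
    exact (mul_eq_zero.1 this).resolve_left hfx
  by_cases hi : x.im = 0
  · have hx0 := hx hi
    have hxr : x = (x.re : ℂ) := by apply Complex.ext <;> simp [hi]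
    rw [hxr] at h0
    have h1 : γ + ∑ i, x.re / (x.re + r i) = 0 := by exact_mod_cast h0
    have h2 : 0 ≤ ∑ i, x.re / (x.re + r i) :=
      sum_nonneg fun i _ => div_nonneg hx0 (by linarith [hr i])
    have h3 : ∑ i, x.re / (x.re + r i) ≤ ∑ i : Fin m, (1 : ℝ) :=
      sum_le_sum fun i _ => (div_le_one (by linarith [hr i])).2 (by linarith [hr i])
    simp only [sum_const, card_univ, Fintype.card_fin, nsmul_eq_mul, mul_one] at h3
    rcases hγ with hγ | hγ <;> linarith
  · have him : ∀ i, (x / (x + r i)).im = x.im * (r i / Complex.normSq (x + r i)) := fun i => by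
      rw [Complex.div_im]
      simp only [Complex.add_re, Complex.add_im, Complex.ofReal_re, Complex.ofReal_im]
      ring
    have h1 := congrArg Complex.im h0
    simp only [Complex.add_im, Complex.ofReal_im, Complex.im_sum, him, ← mul_sum, zero_add,
      Complex.zero_im] at h1
    have h2 := (mul_eq_zero.1 h1).resolve_left hi
    have hpos : ∀ i, 0 < r i / Complex.normSq (x + r i) := fun i => by
      refine div_pos (hr i) (Complex.normSq_pos.2 fun hc => hi ?_)
      simpa using congrArg Complex.im hc
    rw [sum_eq_zero_iff_of_nonneg fun i _ => (hpos i).le] at h2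
    have hm0 : m = 0 := by
      by_contra hc
      exact (hpos ⟨0, Nat.pos_of_ne_zero hc⟩).ne' (h2 _ (mem_univ _))
    subst hm0
    simp only [univ_eq_empty, sum_empty, add_zero, Complex.ofReal_eq_zero] at h0
    have : (0 : ℝ) ≤ n := n.cast_nonneg
    rcases hγ with hγ | hγ <;> linarith

/-- Away from the negative axis, `1 + t x` is bounded below uniformly in `t ≥ 0`. -/
lemma exists_le_norm_one_add_mul {x : ℂ} (hx : x ∈ nonNegAxis) :
    ∃ δ : ℝ, 0 < δ ∧ δ ≤ 1 ∧ ∀ t : ℝ, 0 ≤ t → δ ≤ ‖1 + t * x‖ := by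
  by_cases hr : 0 ≤ x.re
  · refine ⟨1, one_pos, le_rfl, fun t ht => le_trans ?_ (Complex.re_le_norm _)⟩
    simp only [Complex.add_re, Complex.one_re, Complex.re_ofReal_mul]
    nlinarith
  · have hi : x.im ≠ 0 := fun h => hr (hx h)
    have hx0 : 0 < ‖x‖ := norm_pos_iff.2 fun h => hi (by simp [h])
    refine ⟨|x.im| / ‖x‖, div_pos (abs_pos.2 hi) hx0,
      (div_le_one hx0).2 (Complex.abs_im_le_norm x), fun t ht => ?_⟩
    rw [div_le_iff₀ hx0, ← Complex.norm_conj x, ← norm_mul]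
    refine le_trans (le_of_eq ?_) (Complex.abs_im_le_norm _)
    rw [← abs_neg]
    congr 1
    simp
    ring

/-- A polynomial of degree at most `n` with negative roots and `f 0 = 1` is bounded below away
from the negative axis, by a bound which depends only on `n` and the point. -/
lemma exists_pow_le_norm_eval {x : ℂ} (hx : x ∈ nonNegAxis) (n : ℕ) :
    ∃ δ : ℝ, 0 < δ ∧ ∀ f : Polynomial ℂ, f.natDegree ≤ n → (∀ x ∈ nonNegAxis, f.eval x ≠ 0) →
      f.eval 0 = 1 → δ ≤ ‖f.eval x‖ := by
  obtain ⟨δ, hδ, hδ1, hle⟩ := exists_le_norm_one_add_mul hx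
  refine ⟨δ ^ n, pow_pos hδ n, fun f hn hf hf1 => ?_⟩
  have hf0 : f ≠ 0 := by rintro rfl; simp at hf1
  obtain ⟨m, ρ, hm, hroot, hprod, -⟩ := exists_fin_roots hf0 hn
  obtain ⟨r, hr, hρ⟩ := exists_fin_neg_roots hf hroot
  have hfx : f.eval x = ∏ i, (1 + ((r i)⁻¹ : ℝ) * x) := by
    have h1 := hprod 0
    rw [hf1] at h1
    rw [hprod x]
    have h2 : ∏ i, (x - ρ i) = (∏ i, (0 - ρ i)) * ∏ i, (1 + ((r i)⁻¹ : ℝ) * x) := by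
      rw [← prod_mul_distrib]
      refine prod_congr rfl fun i _ => ?_
      have : (r i : ℂ) ≠ 0 := by exact_mod_cast (hr i).ne'
      rw [hρ i]
      push_cast
      field_simp
      ring
    rw [h2, ← mul_assoc, ← h1, one_mul]
  rw [hfx, norm_prod]
  calc δ ^ n ≤ δ ^ m := pow_le_pow_of_le_one hδ.le hδ1 hm
    _ = ∏ i : Fin m, δ := by simp
    _ ≤ _ := prod_le_prod (fun _ _ => hδ.le) fun i _ => hle _ (inv_nonneg.2 (hr i).le)

open Polynomial in
/-- The polynomial `∑ k, (n choose k) * w k * X ^ k`, presented through Pascal's rule. -/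
noncomputable def binomialPoly : ℕ → (ℕ → ℂ) → ℂ[X]
  | 0, w => C (w 0)
  | n + 1, w => binomialPoly n w + X * binomialPoly n fun k => w (k + 1)

namespace binomialPoly

open Polynomial

lemma natDegree_le (n : ℕ) (w : ℕ → ℂ) : (binomialPoly n w).natDegree ≤ n := by
  induction n generalizing w with
  | zero => simp [binomialPoly]
  | succ n ih =>
    refine natDegree_add_le_of_degree_le ((ih w).trans n.le_succ) ?_
    refine natDegree_mul_le.trans ?_
    have := ih fun k => w (k + 1)
    have := natDegree_X_le (R := ℂ)
    omega

lemma congr {n : ℕ} {w w' : ℕ → ℂ} (h : ∀ k ≤ n, w k = w' k) :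
    binomialPoly n w = binomialPoly n w' := by
  induction n generalizing w w' with
  | zero => simp [binomialPoly, h]
  | succ n ih =>
    rw [binomialPoly, binomialPoly, ih fun k hk => h k (by omega),
      ih (w := fun k => w (k + 1)) fun k hk => h (k + 1) (by omega)]

lemma linear (n : ℕ) (c d : ℂ) (w w' : ℕ → ℂ) :
    binomialPoly n (fun k => c * w k + d * w' k) =
      C c * binomialPoly n w + C d * binomialPoly n w' := by
  induction n generalizing w w' with
  | zero => simp [binomialPoly]
  | succ n ih =>
    rw [binomialPoly, binomialPoly, binomialPoly, ih w w',
      ih (fun k => w (k + 1)) fun k => w' (k + 1)]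
    ring

lemma derivative_succ (n : ℕ) (w : ℕ → ℂ) :
    derivative (binomialPoly (n + 1) w) = (n + 1) * binomialPoly n fun k => w (k + 1) := by
  induction n generalizing w with
  | zero => simp [binomialPoly]
  | succ n ih =>
    rw [binomialPoly, derivative_add, derivative_mul, ih w, ih fun k => w (k + 1), derivative_X,
      binomialPoly]
    push_cast
    ring

lemma natCast_mul (n : ℕ) (w : ℕ → ℂ) :
    binomialPoly n (fun k => k * w k) = X * derivative (binomialPoly n w) := by
  induction n generalizing w with
  | zero => simp [binomialPoly]
  | succ n ih =>
    have h : (fun k : ℕ => ((k + 1 : ℕ) : ℂ) * w (k + 1)) =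
        fun k => 1 * (k * w (k + 1)) + 1 * w (k + 1) := by
      funext k; push_cast; ring
    rw [binomialPoly, binomialPoly, ih w, h, linear, ih fun k => w (k + 1), derivative_add,
      derivative_mul, derivative_X, C_1]
    ring

lemma const_one (n : ℕ) : binomialPoly n (fun _ => 1) = (1 + X) ^ n := by
  induction n with
  | zero => simp [binomialPoly]
  | succ n ih => rw [binomialPoly, ih]; ring

lemma eval_zero (n : ℕ) (w : ℕ → ℂ) : (binomialPoly n w).eval 0 = w 0 := by
  induction n with
  | zero => simp [binomialPoly]
  | succ n ih => simp [binomialPoly, ih]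

lemma eval_pow_mul (n : ℕ) (s x : ℂ) (w : ℕ → ℂ) :
    (binomialPoly n fun k => s ^ k * w k).eval x = (binomialPoly n w).eval (s * x) := by
  induction n generalizing w with
  | zero => simp [binomialPoly]
  | succ n ih =>
    have h : (fun k => s ^ (k + 1) * w (k + 1)) =
        fun k => s * (s ^ k * w (k + 1)) + 0 * w k := by
      funext k; ring
    rw [binomialPoly, binomialPoly, h, linear]
    simp [ih]
    ring

lemma tendsto_eval (n : ℕ) (x : ℂ) {w : ℕ → ℕ → ℂ} {w' : ℕ → ℂ}
    (h : ∀ k, Filter.Tendsto (fun m => w m k) Filter.atTop (nhds (w' k))) :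
    Filter.Tendsto (fun m => (binomialPoly n (w m)).eval x) Filter.atTop
      (nhds ((binomialPoly n w').eval x)) := by
  induction n generalizing w w' with
  | zero => simpa [binomialPoly] using h 0
  | succ n ih =>
    simp only [binomialPoly, eval_add, eval_mul, eval_X]
    exact (ih h).add ((ih fun k => h (k + 1)).const_mul x)

lemma add_mul_succ_eval_ne_zero {n : ℕ} {w : ℕ → ℂ}
    (hw : ∀ x : ℂ, 0 ≤ x.re → (binomialPoly (n + 1) w).eval x ≠ 0) {ζ x : ℂ} (hζ : 0 ≤ ζ.re)
    (hx : 0 ≤ x.re) : (binomialPoly n fun k => w k + ζ * w (k + 1)).eval x ≠ 0 := by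
  have h := polar_derivative_ne_zero (natDegree_le (n + 1) w) n.succ_pos hw hζ hx
  have hlin : (fun k => w k + ζ * w (k + 1)) = fun k => 1 * w k + ζ * w (k + 1) := by
    funext k; ring
  contrapose! h
  rw [hlin, linear] at h
  simp only [C_1, one_mul, eval_add, eval_mul, eval_C] at h
  rw [derivative_succ, binomialPoly]
  simp only [eval_add, eval_mul, eval_X, eval_natCast, eval_one]
  push_cast
  linear_combination ((n : ℂ) + 1) * h

lemma add_natCast_mul_eval_ne_zero {n : ℕ} {w : ℕ → ℂ}
    (hw : ∀ x ∈ nonNegAxis, (binomialPoly n w).eval x ≠ 0) {γ : ℝ} (hγ : 0 < γ ∨ γ < -n) {x : ℂ}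
    (hx : x ∈ nonNegAxis) : (binomialPoly n fun k => (γ + k) * w k).eval x ≠ 0 := by
  have h := euler_operator_ne_zero (natDegree_le n w) hw hγ hx
  have hlin : (fun k : ℕ => (γ + k) * w k) = fun k => (γ : ℂ) * w k + 1 * (k * w k) := by
    funext k; ring
  rw [hlin, linear, natCast_mul]
  simpa using h

lemma one_add_mul_eval_ne_zero {n : ℕ} {w : ℕ → ℂ}
    (hw : ∀ x ∈ nonNegAxis, (binomialPoly n w).eval x ≠ 0) {ε : ℝ} (hε : 0 ≤ ε) {x : ℂ}
    (hx : x ∈ nonNegAxis) :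
    (binomialPoly n fun k => (1 + ε * (k * (n - k))) * w k).eval x ≠ 0 := by
  rcases hε.eq_or_lt with rfl | hε
  · simpa using hw x hx
  obtain ⟨α, hα, hαε⟩ : ∃ α : ℝ, 0 < α ∧ ε * (α * (α + n)) = 1 := by
    have hsq : Real.sqrt (n ^ 2 + 4 / ε) ^ 2 = n ^ 2 + 4 / ε := Real.sq_sqrt (by positivity)
    refine ⟨(Real.sqrt (n ^ 2 + 4 / ε) - n) / 2, ?_, ?_⟩
    · have : (n : ℝ) < Real.sqrt (n ^ 2 + 4 / ε) :=
        Real.lt_sqrt_of_sq_lt (by have : 0 < 4 / ε := by positivity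
                                  linarith)
      linarith
    · have : ε * (4 / ε) = 4 := by field_simp
      linear_combination (ε / 4) * hsq + this / 4
  have h1 := fun y hy => add_natCast_mul_eval_ne_zero hw (Or.inl hα) (x := y) hy
  have h2 := add_natCast_mul_eval_ne_zero h1 (γ := -(α + n)) (Or.inr (by linarith)) hx
  have hαε' : (ε : ℂ) * (α * (α + n)) = 1 := by exact_mod_cast hαε
  have hlin : (fun k : ℕ => (1 + ε * (k * (n - k))) * w k) = fun k : ℕ =>
      -(ε : ℂ) * ((((-(α + n) : ℝ) : ℂ) + k) * (((α : ℂ) + k) * w k)) + 0 * w k := by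
    funext k
    push_cast
    linear_combination -w k * hαε'
  rw [hlin, linear]
  simpa [hε.ne'] using h2

lemma one_add_mul_pow_eval_ne_zero (n m : ℕ) {ε : ℝ} (hε : 0 ≤ ε) {x : ℂ}
    (hx : x ∈ nonNegAxis) :
    (binomialPoly n fun k => (1 + ε * (k * (n - k))) ^ m).eval x ≠ 0 := by
  induction m generalizing x with
  | zero =>
    simp only [pow_zero, const_one, eval_pow, eval_add, eval_one, eval_X]
    refine pow_ne_zero _ fun h => ?_
    have hx1 : x = -1 := by linear_combination h
    subst hx1
    have := hx (by simp)
    norm_num at this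
  | succ m ih =>
    simp only [pow_succ']
    exact one_add_mul_eval_ne_zero (fun y hy => ih hy) hε hx

/-- For `b ≥ 1` the polynomial `∑ k, (n choose k) * b ^ (k * (n - k)) * X ^ k` has only negative
roots. -/
lemma pow_mul_sub_eval_ne_zero (n : ℕ) {b : ℝ} (hb : 1 ≤ b) {x : ℂ} (hx : x ∈ nonNegAxis) :
    (binomialPoly n fun k => (b : ℂ) ^ (k * (n - k))).eval x ≠ 0 := by
  obtain ⟨δ, hδ, hle⟩ := exists_pow_le_norm_eval hx n
  have hlog := Real.log_nonneg hb
  have hlim := tendsto_eval n x (w := fun m k => (1 + ((Real.log b / m : ℝ) : ℂ) *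
    (k * (n - k))) ^ m) (w' := fun k => Complex.exp (Real.log b * (k * (n - k)))) fun k => by
      refine (Complex.tendsto_one_add_div_pow_exp _).congr fun m => ?_
      push_cast
      ring
  have hcongr : binomialPoly n (fun k => (b : ℂ) ^ (k * (n - k))) =
      binomialPoly n fun k => Complex.exp (Real.log b * (k * (n - k))) := congr fun k hk => by
    have h1 : (b : ℂ) = Complex.exp (Real.log b) := by
      rw [← Complex.ofReal_exp, Real.exp_log (by linarith)]
    rw [h1, ← Complex.exp_nat_mul]
    push_cast [Nat.cast_sub hk]
    congr 1
    ring
  rw [hcongr]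
  refine norm_pos_iff.1 (hδ.trans_le (ge_of_tendsto' hlim.norm fun m => ?_))
  exact hle _ (natDegree_le _ _)
    (fun y hy => one_add_mul_pow_eval_ne_zero n m (div_nonneg hlog m.cast_nonneg) hy)
    (by simp [eval_zero])

end binomialPoly

/-- A product over the vertices of a local half-plane stable symmetric function of the half-edges
at that vertex is half-plane stable (Grace–Walsh–Szegő). -/
lemma sum_powerset_prod_ne_zero {V H : Type*} [Fintype V] [DecidableEq V] [DecidableEq H]
    (π : H → V) (F : Finset H) (w : V → ℕ → ℂ)
    (hw : ∀ v, ∀ x : ℂ, 0 ≤ x.re → (binomialPoly #{h ∈ F | π h = v} (w v)).eval x ≠ 0)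
    (x : H → ℂ) (hx : ∀ h, 0 ≤ (x h).re) :
    ∑ S ∈ F.powerset, (∏ v, w v #{h ∈ S | π h = v}) * ∏ h ∈ S, x h ≠ 0 := by
  induction F using Finset.induction_on generalizing w with
  | empty =>
    simp only [powerset_empty, sum_singleton, filter_empty, card_empty, prod_empty, mul_one]
    exact prod_ne_zero_iff.2 fun v _ => by simpa [binomialPoly] using hw v 0 le_rfl
  | insert h F hF ih =>
    set w' : V → ℕ → ℂ :=
      Function.update w (π h) fun k => w (π h) k + x h * w (π h) (k + 1) with hw'
    have hcard : ∀ S : Finset H, h ∉ S → ∀ v,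
        #{g ∈ insert h S | π g = v} = #{g ∈ S | π g = v} + if π h = v then 1 else 0 := by
      intro S hS v
      rw [filter_insert]
      split_ifs
      · rw [card_insert_of_notMem fun hc => hS (mem_filter.1 hc).1]
      · rfl
    have key := ih w' fun v y hy => by
      have hv := hw v
      rw [hcard F hF] at hv
      by_cases hvh : π h = v
      · subst hvh
        rw [hw', Function.update_self]
        rw [if_pos rfl] at hv
        exact binomialPoly.add_mul_succ_eval_ne_zero hv (hx h) hy
      · rw [hw', Function.update_of_ne (Ne.symm hvh)]
        rw [if_neg hvh, add_zero] at hv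
        exact hv y hy
    rw [sum_powerset_insert hF, ← sum_add_distrib]
    refine fun h0 => key (Eq.trans (sum_congr rfl fun S hS => ?_) h0)
    symm
    have hhS : h ∉ S := fun hc => hF (mem_powerset.1 hS hc)
    rw [prod_insert hhS]
    simp only [hcard S hhS]
    rw [← mul_prod_erase univ (fun v => w v #{g ∈ S | π g = v}) (mem_univ (π h)),
      ← mul_prod_erase univ (fun v => w v (#{g ∈ S | π g = v} + if π h = v then 1 else 0))
        (mem_univ (π h)),
      ← mul_prod_erase univ (fun v => w' v #{g ∈ S | π g = v}) (mem_univ (π h))]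
    have h1 : ∏ v ∈ univ.erase (π h), w v (#{g ∈ S | π g = v} + if π h = v then 1 else 0) =
        ∏ v ∈ univ.erase (π h), w v #{g ∈ S | π g = v} :=
      prod_congr rfl fun v hv => by rw [if_neg (ne_of_mem_erase hv).symm, add_zero]
    have h2 : ∏ v ∈ univ.erase (π h), w' v #{g ∈ S | π g = v} =
        ∏ v ∈ univ.erase (π h), w v #{g ∈ S | π g = v} :=
      prod_congr rfl fun v hv => by rw [hw', Function.update_of_ne (ne_of_mem_erase hv)]
    rw [h1, h2, hw', Function.update_self, if_pos rfl]
    ring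

/-- Contraction of a bilinear polynomial without zeros in the closed right half-plane. -/
lemma add_ne_zero_of_bilinear {A B C D : ℂ}
    (h : ∀ x y : ℂ, 0 ≤ x.re → 0 ≤ y.re → A + B * x + C * y + D * (x * y) ≠ 0) : A + D ≠ 0 := by
  intro hD
  obtain rfl : D = -A := by linear_combination hD
  have hA : A ≠ 0 := by simpa using h 0 0
  obtain ⟨β, rfl⟩ : ∃ β, B = A * β := ⟨B / A, by field_simp⟩
  obtain ⟨γ, rfl⟩ : ∃ γ, C = A * γ := ⟨C / A, by field_simp⟩
  have h' : ∀ x y : ℂ, 0 ≤ x.re → 0 ≤ y.re → 1 + β * x + γ * y - x * y ≠ 0 := fun x y hx hy h0 =>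
    h x y hx hy (by linear_combination A * h0)
  have key : ∀ u : ℂ, (∀ x : ℂ, 0 ≤ x.re → 1 + u * x ≠ 0) → u = 0 ∨ 0 < u.re := by
    intro u hu
    by_contra! hc
    refine hu (-1 / u) ?_ (by field_simp [hc.1]; ring)
    rw [neg_div, one_div, Complex.neg_re, Complex.inv_re, ← neg_div]
    exact div_nonneg (by linarith [hc.2]) (Complex.normSq_nonneg _)
  have hβ := key β fun x hx => by simpa using h' x 0 hx le_rfl
  have hγ := key γ fun y hy => by simpa using h' 0 y le_rfl hy
  have hγ0 : 0 ≤ γ.re := by rcases hγ with rfl | hγ <;> simp [*, le_of_lt]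
  have main : ∀ s : ℝ, 0 < s → 0 ≤ (β + (1 + β * γ) * (s⁻¹ : ℝ)).re → False := by
    intro s hs hre
    refine h' (γ + s) (β + (1 + β * γ) * (s⁻¹ : ℝ)) (by simp; linarith) hre ?_
    have : (s : ℂ) ≠ 0 := by exact_mod_cast hs.ne'
    push_cast
    field_simp
    ring
  rcases hβ with rfl | hβ
  · exact main 1 one_pos (by simp)
  · have hs : 0 < (|(1 + β * γ).re| + 1) / β.re := by positivity
    refine main _ hs ?_
    rw [Complex.add_re, mul_comm, Complex.re_ofReal_mul, inv_div]
    have h1 := neg_abs_le (1 + β * γ).re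
    have h2 : 0 < |(1 + β * γ).re| + 1 := by positivity
    rw [div_mul_eq_mul_div, ← sub_neg_eq_add, ← neg_div, sub_nonneg, div_le_iff₀ h2]
    nlinarith

/-- Restricting a half-plane stable multi-affine polynomial in paired variables to its diagonal
terms yields a nonzero number. -/
lemma sum_diag_ne_zero {E : Type*} [DecidableEq E] (F : Finset E) (c : Finset E → Finset E → ℂ)
    (h : ∀ x y : E → ℂ, (∀ e, 0 ≤ (x e).re) → (∀ e, 0 ≤ (y e).re) →
      ∑ S ∈ F.powerset, ∑ T ∈ F.powerset, c S T * ((∏ e ∈ S, x e) * ∏ e ∈ T, y e) ≠ 0) :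
    ∑ S ∈ F.powerset, c S S ≠ 0 := by
  induction F using Finset.induction_on generalizing c with
  | empty => simpa using h 0 0
  | insert e F he ih =>
    rw [sum_powerset_insert he, ← sum_add_distrib]
    refine ih (fun S T => c S T + c (insert e S) (insert e T)) fun x y hx hy => ?_
    simp only [add_mul, sum_add_distrib]
    have hx' : ∀ a : ℂ, ∀ S ∈ F.powerset, ∏ i ∈ S, Function.update x e a i = ∏ i ∈ S, x i :=
      fun a S hS => prod_congr rfl fun i hi => Function.update_of_ne
        (ne_of_mem_of_not_mem (mem_powerset.1 hS hi) he) _ _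
    have hy' : ∀ a : ℂ, ∀ S ∈ F.powerset, ∏ i ∈ S, Function.update y e a i = ∏ i ∈ S, y i :=
      fun a S hS => prod_congr rfl fun i hi => Function.update_of_ne
        (ne_of_mem_of_not_mem (mem_powerset.1 hS hi) he) _ _
    refine add_ne_zero_of_bilinear
      (B := ∑ S ∈ F.powerset, ∑ T ∈ F.powerset,
        c (insert e S) T * ((∏ e ∈ S, x e) * ∏ e ∈ T, y e))
      (C := ∑ S ∈ F.powerset, ∑ T ∈ F.powerset,
        c S (insert e T) * ((∏ e ∈ S, x e) * ∏ e ∈ T, y e)) fun a b ha hb => ?_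
    convert h (Function.update x e a) (Function.update y e b)
      (fun i => by by_cases hi : i = e <;> simp [hi, ha, hx])
      (fun i => by by_cases hi : i = e <;> simp [hi, hb, hy]) using 1
    simp only [sum_powerset_insert he, sum_mul, ← sum_add_distrib]
    refine sum_congr rfl fun S hS => ?_
    refine sum_congr rfl fun T hT => ?_
    have hS' : e ∉ S := fun hc => he (mem_powerset.1 hS hc)
    have hT' : e ∉ T := fun hc => he (mem_powerset.1 hT hc)
    rw [prod_insert hS', prod_insert hT', hx' a S hS, hy' b T hT, Function.update_self,
      Function.update_self]
    ring

/-- The number of edges of the line graph cut by `U`, counted at the vertices of `G`. -/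
lemma cutCard_lineGraph {V : Type*} [Fintype V] [DecidableEq V] (G : SimpleGraph V)
    [Fintype G.edgeSet] (U : Finset G.edgeSet) :
    cutCard G.lineGraph U = ∑ v, #{e ∈ U | v ∈ e.1} * #{e ∈ Uᶜ | v ∈ e.1} := by
  classical
  have himage : {e : Sym2 G.edgeSet | e ∈ G.lineGraph.edgeSet ∧
      ∃ u v : G.edgeSet, e = s(u, v) ∧ u ∈ U ∧ v ∉ U} =
      ((({p ∈ U ×ˢ Uᶜ | G.lineGraph.Adj p.1 p.2}).image fun p => s(p.1, p.2) :
        Finset (Sym2 G.edgeSet)) : Set (Sym2 G.edgeSet)) := by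
    ext e
    simp only [Set.mem_ofPred_eq, coe_image, Set.mem_image, mem_coe, mem_filter, mem_product,
      mem_compl, Prod.exists]
    constructor
    · rintro ⟨he, u, v, rfl, hu, hv⟩
      exact ⟨u, v, ⟨⟨hu, hv⟩, he⟩, rfl⟩
    · rintro ⟨u, v, ⟨⟨hu, hv⟩, he⟩, rfl⟩
      exact ⟨he, u, v, rfl, hu, hv⟩
  rw [cutCard, himage, Set.ncard_coe_finset, card_image_of_injOn]
  · have hcount : ∀ p ∈ U ×ˢ Uᶜ, (if G.lineGraph.Adj p.1 p.2 then 1 else 0) =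
        ∑ v, if v ∈ p.1.1 ∧ v ∈ p.2.1 then 1 else 0 := by
      rintro ⟨e, f⟩ hp
      simp only [mem_product, mem_compl] at hp
      have hef : e ≠ f := fun h => hp.2 (h ▸ hp.1)
      simp only [SimpleGraph.lineGraph_adj_iff_exists, ne_eq, hef, not_false_eq_true, true_and]
      rw [← card_filter]
      split_ifs with hv
      · obtain ⟨v, hve, hvf⟩ := hv
        refine (card_eq_one.2 ⟨v, ?_⟩).symm
        ext u
        simp only [mem_filter, mem_univ, true_and, mem_singleton]
        refine ⟨fun hu => ?_, fun hu => hu ▸ ⟨hve, hvf⟩⟩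
        by_contra huv
        exact hef (Subtype.ext (Sym2.eq_of_ne_mem huv hu.1 hve hu.2 hvf))
      · symm
        rw [card_eq_zero, filter_eq_empty_iff]
        exact fun v _ h => hv ⟨v, h⟩
    rw [card_filter, sum_congr rfl hcount, sum_comm]
    refine sum_congr rfl fun v _ => ?_
    rw [← card_filter, ← card_product, ← filter_product]
  · rintro ⟨u, v⟩ hp ⟨u', v'⟩ hp' h
    simp only [coe_filter, mem_product, mem_compl, Set.mem_ofPred_eq] at hp hp'
    simp only [Sym2.eq_iff] at h
    rcases h with ⟨rfl, rfl⟩ | ⟨rfl, rfl⟩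
    · rfl
    · exact absurd hp.1.1 hp'.1.2

lemma exists_sq_eq_of_mem_nonNegAxis {z : ℂ} (hz : z ∈ nonNegAxis) :
    ∃ s : ℂ, s ^ 2 = z ∧ ∀ x : ℂ, 0 ≤ x.re → s * x ∈ nonNegAxis := by
  by_cases h0 : z = 0
  · exact ⟨0, by simp [h0], fun x _ => by simp [nonNegAxis]⟩
  obtain ⟨s, hs⟩ : ∃ s : ℂ, s ^ 2 = z := IsAlgClosed.exists_pow_nat_eq z two_pos
  wlog hre : 0 ≤ s.re generalizing s
  · exact this (-s) (by rw [neg_sq, hs]) (by rw [Complex.neg_re]; linarith)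
  have hre : 0 < s.re := by
    refine lt_of_le_of_ne hre fun h => h0 ?_
    have h1 : z.im = 0 := by rw [← hs, sq, Complex.mul_im, ← h]; ring
    have h2 := hz h1
    rw [← hs, sq, Complex.mul_re, ← h] at h2
    have h3 : s.im = 0 := by nlinarith
    have h4 : s = 0 := Complex.ext h.symm h3
    rw [← hs, h4]; simp
  refine ⟨s, hs, fun x hx him => ?_⟩
  rw [Complex.mul_im] at him
  rw [Complex.mul_re]
  have h1 : s.re * (s.re * x.re - s.im * x.im) = x.re * (s.re ^ 2 + s.im ^ 2) := by
    linear_combination -s.im * him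
  have h2 : 0 ≤ s.re * (s.re * x.re - s.im * x.im) := by rw [h1]; positivity
  exact nonneg_of_mul_nonneg_right h2 hre

/-- The partition function of the line graph has no zero off the negative real axis. -/
lemma isingZ_lineGraph_ne_zero {V : Type*} [Fintype V] (G : SimpleGraph V) [Fintype G.edgeSet]
    {b : ℝ} (hb : 1 ≤ b) {z : ℂ} (hz : z ∈ nonNegAxis) : isingZ G.lineGraph z b ≠ 0 := by
  classical
  obtain ⟨s, rfl, hs⟩ := exists_sq_eq_of_mem_nonNegAxis hz
  obtain ⟨l, r, hlr⟩ : ∃ l r : G.edgeSet → V, ∀ e, e.1 = s(l e, r e) := by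
    have : ∀ e : G.edgeSet, ∃ p : V × V, e.1 = s(p.1, p.2) := fun e =>
      e.1.ind fun x y => ⟨(x, y), rfl⟩
    choose p hp using this
    exact ⟨fun e => (p e).1, fun e => (p e).2, hp⟩
  have hne : ∀ e, l e ≠ r e := fun e => by
    have := e.2
    rw [hlr e, SimpleGraph.mem_edgeSet] at this
    exact this.ne
  set π : G.edgeSet ⊕ G.edgeSet → V := Sum.elim l r with hπ
  have hdeg : ∀ (U : Finset G.edgeSet) (v : V),
      #{h ∈ U.disjSum U | π h = v} = #{e ∈ U | v ∈ e.1} := fun U v => by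
    simp only [card_filter, sum_disjSum, hπ, Sum.elim_inl, Sum.elim_inr, ← sum_add_distrib]
    refine sum_congr rfl fun e _ => ?_
    have hmem : v ∈ e.1 ↔ l e = v ∨ r e = v := by
      rw [hlr e, Sym2.mem_iff, eq_comm (a := v), eq_comm (a := v)]
    by_cases h1 : l e = v
    · have h2 : r e ≠ v := fun h => hne e (h1.trans h.symm)
      simp [hmem, h1, h2]
    · by_cases h2 : r e = v <;> simp [hmem, h1, h2]
  set w : V → ℕ → ℂ := fun v k =>
    s ^ k * (b : ℂ) ^ (k * (#{h ∈ (univ : Finset (G.edgeSet ⊕ G.edgeSet)) | π h = v} - k)) with hw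
  have key := sum_diag_ne_zero univ
    (fun S T : Finset G.edgeSet => ∏ v, w v #{h ∈ S.disjSum T | π h = v}) fun x y hx hy => by
      have h := sum_powerset_prod_ne_zero π univ w
        (fun v x hx => by
          rw [binomialPoly.eval_pow_mul]
          exact binomialPoly.pow_mul_sub_eval_ne_zero _ hb (hs x hx))
        (Sum.elim x y) (by rintro (e | e) <;> simp [hx, hy])
      rw [powerset_univ, ← Finset.sumEquiv.symm.toEquiv.sum_comp, Fintype.sum_prod_type] at h
      rw [powerset_univ]
      simpa [prod_disjSum] using h
  rw [powerset_univ] at key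
  rw [isingZ]
  refine fun h => key (Eq.trans (sum_congr rfl fun U _ => ?_) h)
  symm
  rw [cutCard_lineGraph, ← prod_pow_eq_pow_sum]
  simp only [hw, prod_mul_distrib, ← univ_disjSum_univ, hdeg]
  congr 1
  · rw [prod_pow_eq_pow_sum, ← pow_mul]
    congr 1
    simp only [← hdeg]
    rw [← card_eq_sum_card_fiberwise (f := π) (t := univ) fun _ _ => mem_coe.2 (mem_univ _),
      card_disjSum, two_mul]
  · refine prod_congr rfl fun v _ => ?_
    have h1 : #{e : G.edgeSet | v ∈ e.1} = #{e ∈ U | v ∈ e.1} + #{e ∈ Uᶜ | v ∈ e.1} := by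
      rw [← card_union_of_disjoint (disjoint_filter_filter disjoint_compl_right), ← filter_union,
        union_compl]
    rw [h1, Nat.add_sub_cancel_left]

/-- Every complex root of `z ↦ Z_{L(G)}(z, b)` (for real `b ≥ 1`) is a negative real number. -/
theorem ising_lineGraph_roots_real_negative
    {V : Type} [Fintype V] (G : SimpleGraph V) (b : ℝ) (hb : 1 ≤ b)
    (z : ℂ) (hz : isingLineGraph G z (b : ℂ) = 0) :
    ∃ r : ℝ, r < 0 ∧ z = (r : ℂ) := by
  by_cases h : z ∈ nonNegAxis
  · let : Fintype G.edgeSet := Fintype.ofFinite _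
    exact absurd hz (isingZ_lineGraph_ne_zero G hb h)
  · obtain ⟨r, hr, rfl⟩ := exists_neg_of_notMem_nonNegAxis h
    exact ⟨-r, neg_lt_zero.2 hr, by push_cast; rfl⟩
end

section
/- Fix a real number b > 0 and for each integer d ≥ 0 define K_d(z) = Σ_{i=0}^d C(d, i) b^{−C(d−i, 2) − C(i, 2)} z^i. Then for every d ≥ 0 and every complex z, K_{d+1}(z) = b^{−d} K_d(bz) + z K_d(b^{−1} z). -/
open Finset

/-- The key polynomial of the Ising model on line graphs:
`K_d(z) = Σ_{i=0}^d C(d,i) b^{-C(d-i,2)-C(i,2)} z^i`. -/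
noncomputable def keyIsing (b : ℝ) (d : ℕ) (z : ℂ) : ℂ :=
  ∑ i ∈ Finset.range (d + 1),
    (d.choose i : ℂ) * (b : ℂ) ^ (-(((d - i).choose 2 + i.choose 2 : ℕ) : ℤ)) * z ^ i

/-- Pascal's rule, summed against an arbitrary weight. -/
theorem sum_range_choose_succ_mul {R : Type*} [CommSemiring R] (d : ℕ) (w : ℕ → R) :
    ∑ i ∈ Finset.range (d + 2), ((d + 1).choose i : R) * w i =
      ∑ i ∈ Finset.range (d + 1), (d.choose i : R) * w i +
        ∑ i ∈ Finset.range (d + 1), (d.choose i : R) * w (i + 1) := by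
  have h : ∑ i ∈ Finset.range (d + 1), (d.choose i : R) * w i =
      ∑ i ∈ Finset.range (d + 2), (d.choose i : R) * w i := by
    simp [Finset.sum_range_succ _ (d + 1)]
  rw [h, Finset.sum_range_succ', Finset.sum_range_succ' _ (d + 1)]
  simp only [Nat.choose_succ_succ', Nat.cast_add, add_mul, Finset.sum_add_distrib,
    Nat.choose_zero_right]
  ring

theorem choose_two_succ (n : ℕ) : (n + 1).choose 2 = n.choose 2 + n := by
  rw [Nat.choose_succ_succ' n 1, Nat.choose_one_right, add_comm]

/-- The recursion `K_{d+1}(z) = b^{-d} K_d(bz) + z K_d(b⁻¹ z)` for `b > 0`. -/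
theorem keyIsing_recursion (b : ℝ) (hb : 0 < b) (d : ℕ) (z : ℂ) :
    keyIsing b (d + 1) z =
      (b : ℂ) ^ (-(d : ℤ)) * keyIsing b d ((b : ℂ) * z) +
        z * keyIsing b d ((b : ℂ)⁻¹ * z) := by
  have hb0 : (b : ℂ) ≠ 0 := by exact_mod_cast hb.ne'
  simp only [keyIsing, mul_assoc]
  rw [sum_range_choose_succ_mul, Finset.mul_sum, Finset.mul_sum]
  congr 1 <;> refine Finset.sum_congr rfl fun i hi => ?_
  · have hid : i ≤ d := Nat.lt_succ_iff.mp (Finset.mem_range.mp hi)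
    have e : (-(((d + 1 - i).choose 2 + i.choose 2 : ℕ) : ℤ)) =
        -(d : ℤ) + -(((d - i).choose 2 + i.choose 2 : ℕ) : ℤ) + (i : ℤ) := by
      rw [Nat.succ_sub hid, Nat.succ_eq_add_one, choose_two_succ]
      push_cast [Nat.cast_sub hid]
      ring
    rw [e, zpow_add₀ hb0, zpow_add₀ hb0, zpow_natCast, mul_pow]
    ring
  · have e : (-(((d + 1 - (i + 1)).choose 2 + (i + 1).choose 2 : ℕ) : ℤ)) =
        -(((d - i).choose 2 + i.choose 2 : ℕ) : ℤ) + -(i : ℤ) := by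
      rw [Nat.add_sub_add_right, choose_two_succ]
      push_cast
      ring
    rw [e, zpow_add₀ hb0, zpow_neg _ (i : ℤ), zpow_natCast, mul_pow, inv_pow]
    ring
end

section
/- Let G = (V, E) be a finite simple graph, let b_v ≥ 1 be real numbers for v ∈ V, and define F_{L(G)}(λ, (b_v)) = Σ_{F ⊆ E} Π_{v ∈ V} b_v^{−C(d_G(v) − d_F(v), 2) − C(d_F(v), 2)} λ_v^{d_F(v)}, a polynomial in the variables (λ_v)_{v ∈ V}. Then F_{L(G)}(λ, (b_v)) ≠ 0 whenever every λ_v satisfies |arg(λ_v)| < π/2 (i.e., F_{L(G)} is weakly Hurwitz-stable). -/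
open Finset

/-- The number of edges in the edge subset `F` containing the vertex `v`. -/
def subDeg {V : Type*} [DecidableEq V] (F : Finset (Sym2 V)) (v : V) : ℕ :=
  (F.filter (fun e => v ∈ e)).card

/-- The multivariate polynomial
`F_{L(G)}(λ, (b_v)) = Σ_{F ⊆ E} Π_v b_v^{-C(d_G(v)-d_F(v),2)-C(d_F(v),2)} λ_v^{d_F(v)}`. -/
noncomputable def FLG {V : Type*} [Fintype V] [DecidableEq V]
    (G : SimpleGraph V) [DecidableRel G.Adj] (lam : V → ℂ) (b : V → ℂ) : ℂ :=
  ∑ F ∈ G.edgeFinset.powerset, ∏ v : V,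
    b v ^ (-(((G.degree v - subDeg F v).choose 2 + (subDeg F v).choose 2 : ℕ) : ℤ)) *
      lam v ^ subDeg F v

open Polynomial

lemma re_root_nonpos {p : ℂ[X]} (hp : ∀ x : ℂ, 0 < x.re → p.eval x ≠ 0) {r : ℂ}
    (hr : r ∈ p.roots) : r.re ≤ 0 := by
  by_contra! h
  exact hp r h (isRoot_of_mem_roots hr)

lemma eval_add_mul_derivative_ne_zero {p : ℂ[X]}
    (hp : ∀ x : ℂ, 0 < x.re → p.eval x ≠ 0) {ε : ℝ} (hε : 0 ≤ ε) {x : ℂ} (hx : 0 < x.re) :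
    p.eval x + ε * (x * p.derivative.eval x) ≠ 0 := by
  have hx0 : x ≠ 0 := by rintro rfl; simp at hx
  rw [(IsAlgClosed.splits p).eval_derivative_eq_eval_mul_sum (hp x hx)]
  set S := (p.roots.map fun z ↦ 1 / (x - z)).sum with hS
  have hSre : 0 ≤ S.re := by
    refine Multiset.sum_induction (fun z : ℂ => 0 ≤ z.re) _ (fun a b => add_nonneg) le_rfl ?_
    simp only [Multiset.mem_map]
    rintro _ ⟨r, hr, rfl⟩
    have := re_root_nonpos hp hr
    rw [one_div, Complex.inv_re]
    exact div_nonneg (by rw [Complex.sub_re]; linarith) (Complex.normSq_nonneg _)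
  have h1 : 0 < (x⁻¹ + ε * S).re := by
    have : 0 < (x⁻¹).re := by
      rw [Complex.inv_re]; exact div_pos hx (Complex.normSq_pos.2 hx0)
    simp only [Complex.add_re, Complex.re_ofReal_mul]
    positivity
  have h2 : p.eval x + ε * (x * (p.eval x * S)) = p.eval x * x * (x⁻¹ + ε * S) := by
    field_simp
  rw [h2]
  refine mul_ne_zero (mul_ne_zero (hp x hx) hx0) fun h => ?_
  simp [h] at h1

lemma eval_sub_mul_derivative_ne_zero {p : ℂ[X]}
    (hp : ∀ x : ℂ, 0 < x.re → p.eval x ≠ 0) {ε : ℝ} (hε : 0 ≤ ε) (hε' : ε * p.natDegree < 1)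
    {x : ℂ} (hx : 0 < x.re) :
    p.eval x - ε * (x * p.derivative.eval x) ≠ 0 := by
  have hx0 : x ≠ 0 := by rintro rfl; simp at hx
  rw [(IsAlgClosed.splits p).eval_derivative_eq_eval_mul_sum (hp x hx)]
  set S := (p.roots.map fun z ↦ 1 / (x - z)).sum with hS
  have key : ∀ s : Multiset ℂ, (∀ r ∈ s, r.re ≤ 0) →
      0 ≤ (x * (s.card - x * (s.map fun z ↦ 1 / (x - z)).sum)).re := by
    intro s
    induction s using Multiset.induction_on with
    | empty => simp
    | cons r s ih =>
      intro h
      have h1 := ih fun t ht => h t (Multiset.mem_cons_of_mem ht)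
      have hr := h r (Multiset.mem_cons_self r s)
      have hxr : x - r ≠ 0 := by
        intro h0; rw [sub_eq_zero] at h0; subst h0; linarith
      have e : x * (((r ::ₘ s).card : ℂ) - x * ((r ::ₘ s).map fun z ↦ 1 / (x - z)).sum)
          = x * (s.card - x * (s.map fun z ↦ 1 / (x - z)).sum) + (-(x * r)) / (x - r) := by
        simp only [Multiset.card_cons, Multiset.map_cons, Multiset.sum_cons]
        push_cast
        field_simp
        ring
      rw [e, Complex.add_re]
      have : 0 ≤ ((-(x * r)) / (x - r)).re := by
        rw [Complex.div_re, ← add_div]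
        refine div_nonneg ?_ (Complex.normSq_nonneg _)
        simp
        nlinarith [mul_nonneg (neg_nonneg.2 hr) (Complex.normSq_nonneg x),
          mul_nonneg hx.le (Complex.normSq_nonneg r), Complex.normSq_apply x,
          Complex.normSq_apply r]
      linarith
  have hk := key p.roots fun r hr => re_root_nonpos hp hr
  rw [← (IsAlgClosed.splits p).natDegree_eq_card_roots, ← hS] at hk
  have h1 : 0 < (x * (1 - ε * (x * S))).re := by
    have e : x * (1 - ε * (x * S)) = ((1 - ε * p.natDegree : ℝ) : ℂ) * x +
        (ε : ℂ) * (x * (p.natDegree - x * S)) := by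
      push_cast; ring
    rw [e, Complex.add_re, Complex.re_ofReal_mul, Complex.re_ofReal_mul]
    have := mul_pos (sub_pos.2 hε') hx
    positivity
  have h2 : p.eval x - ε * (x * (p.eval x * S)) = p.eval x * (1 - ε * (x * S)) := by ring
  rw [h2]
  refine mul_ne_zero (hp x hx) fun h => ?_
  simp [h] at h1


lemma norm_leadingCoeff_mul_re_pow_le {p : ℂ[X]} (hp : ∀ x : ℂ, 0 < x.re → p.eval x ≠ 0)
    {x : ℂ} (hx : 0 < x.re) : ‖p.leadingCoeff‖ * x.re ^ p.natDegree ≤ ‖p.eval x‖ := by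
  have key : ∀ s : Multiset ℂ, (∀ r ∈ s, r.re ≤ 0) →
      x.re ^ s.card ≤ ‖(s.map (x - ·)).prod‖ := by
    intro s
    induction s using Multiset.induction_on with
    | empty => simp
    | cons r s ih =>
      intro h
      have h1 := ih fun t ht => h t (Multiset.mem_cons_of_mem ht)
      have h2 : x.re ≤ ‖x - r‖ := by
        have h3 := Complex.re_le_norm (x - r)
        have hr := h r (Multiset.mem_cons_self r s)
        rw [Complex.sub_re] at h3
        linarith
      rw [Multiset.card_cons, Multiset.map_cons, Multiset.prod_cons, norm_mul, pow_succ']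
      gcongr
  rw [(IsAlgClosed.splits p).eval_eq_prod_roots, norm_mul,
    (IsAlgClosed.splits p).natDegree_eq_card_roots]
  gcongr
  exact key _ fun r hr => re_root_nonpos hp hr

section GaussianMultiplier

variable {ι : Type*} {s : Finset ι} {c : ι → ℂ} {n : ι → ℕ}

/-- The polynomial `∑ i ∈ s, c i X ^ n i`. -/
noncomputable def monomialSum (s : Finset ι) (n : ι → ℕ) (c : ι → ℂ) : ℂ[X] :=
  ∑ i ∈ s, C (c i) * X ^ n i

lemma eval_monomialSum (x : ℂ) : (monomialSum s n c).eval x = ∑ i ∈ s, c i * x ^ n i := by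
  simp [monomialSum, eval_finsetSum]

lemma coeff_monomialSum_mul (w : ℕ → ℂ) (k : ℕ) :
    (monomialSum s n fun i => c i * w (n i)).coeff k = (monomialSum s n c).coeff k * w k := by
  simp only [monomialSum, finsetSum_coeff, coeff_C_mul, coeff_X_pow, Finset.sum_mul]
  refine Finset.sum_congr rfl fun i _ => ?_
  split_ifs with h <;> simp [h]

lemma natDegree_monomialSum_le {d : ℕ} (hd : ∀ i ∈ s, n i ≤ d) :
    (monomialSum s n c).natDegree ≤ d :=
  natDegree_sum_le_of_forall_le _ _ fun i hi => (natDegree_C_mul_X_pow_le _ _).trans (hd i hi)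

lemma mul_eval_derivative_monomialSum (x : ℂ) :
    x * (monomialSum s n c).derivative.eval x = ∑ i ∈ s, c i * n i * x ^ n i := by
  simp only [monomialSum, derivative_sum, eval_finsetSum, Finset.mul_sum]
  refine Finset.sum_congr rfl fun i _ => ?_
  rcases h : n i with _ | k
  · simp
  · simp; ring

lemma sum_mul_one_sub_sq_ne_zero (hc : ∀ x : ℂ, 0 < x.re → ∑ i ∈ s, c i * x ^ n i ≠ 0)
    {d : ℕ} (hd : ∀ i ∈ s, n i ≤ d) {ε : ℝ} (hε : 0 ≤ ε) (hεd : ε * d < 1) {x : ℂ}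
    (hx : 0 < x.re) : ∑ i ∈ s, c i * (1 - (ε * n i) ^ 2) * x ^ n i ≠ 0 := by
  have h1 : ∀ y : ℂ, 0 < y.re → (monomialSum s n fun i => c i * (1 + ε * n i)).eval y ≠ 0 := by
    intro y hy
    have := eval_add_mul_derivative_ne_zero (p := monomialSum s n c)
      (fun z hz => by rw [eval_monomialSum]; exact hc z hz) hε hy
    rw [mul_eval_derivative_monomialSum, eval_monomialSum, Finset.mul_sum,
      ← Finset.sum_add_distrib] at this
    rw [eval_monomialSum]
    convert this using 2
    ring
  have h2 : ε * (monomialSum s n fun i => c i * (1 + ε * n i)).natDegree < 1 := by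
    refine lt_of_le_of_lt ?_ hεd
    gcongr
    exact natDegree_monomialSum_le hd
  have := eval_sub_mul_derivative_ne_zero h1 hε h2 hx
  rw [mul_eval_derivative_monomialSum, eval_monomialSum, Finset.mul_sum,
    ← Finset.sum_sub_distrib] at this
  convert this using 2
  ring

lemma sum_mul_one_add_div_pow_ne_zero
    (hc : ∀ x : ℂ, 0 < x.re → ∑ i ∈ s, c i * x ^ n i ≠ 0)
    {d : ℕ} (hd : ∀ i ∈ s, n i ≤ d) {t : ℝ} (ht : 0 ≤ t) {N : ℕ} (hN : t * d ^ 2 < N) (m : ℕ)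
    {x : ℂ} (hx : 0 < x.re) :
    ∑ i ∈ s, c i * (((1 + -(t * n i ^ 2) / N) ^ m : ℝ) : ℂ) * x ^ n i ≠ 0 := by
  have hN0 : (0 : ℝ) < N := lt_of_le_of_lt (by positivity) hN
  induction m generalizing x with
  | zero => simpa using hc x hx
  | succ m ih =>
    have h1 : √(t / N) * d < 1 := by
      rw [← abs_of_nonneg (by positivity : 0 ≤ √(t / N) * d), ← sq_lt_one_iff_abs_lt_one,
        mul_pow, Real.sq_sqrt (by positivity), div_mul_eq_mul_div, div_lt_one hN0]
      exact hN
    have := sum_mul_one_sub_sq_ne_zero (fun y hy => ih hy) hd (Real.sqrt_nonneg (t / N)) h1 hx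
    convert this using 3 with i
    have h2 : ((√(t / N) : ℝ) : ℂ) ^ 2 = t / N := by
      rw [← Complex.ofReal_pow, Real.sq_sqrt (by positivity)]; push_cast; rfl
    rw [mul_pow, h2]
    push_cast
    ring

theorem sum_mul_exp_neg_sq_ne_zero
    (hc : ∀ x : ℂ, 0 < x.re → ∑ i ∈ s, c i * x ^ n i ≠ 0) {t : ℝ} (ht : 0 ≤ t)
    {x : ℂ} (hx : 0 < x.re) :
    ∑ i ∈ s, c i * (Real.exp (-(t * n i ^ 2)) : ℂ) * x ^ n i ≠ 0 := by
  set p := monomialSum s n c with hp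
  have hp0 : p ≠ 0 := by
    intro h
    refine hc x hx ?_
    rw [← eval_monomialSum, ← hp, h, eval_zero]
  let w : ℕ → ℕ → ℝ := fun N k => (1 + -(t * k ^ 2) / N) ^ N
  have hw : ∀ k, Filter.Tendsto (fun N => w N k) Filter.atTop
      (nhds (Real.exp (-(t * k ^ 2)))) := fun k => Real.tendsto_one_add_div_pow_exp _
  let q : ℕ → ℂ[X] := fun N => monomialSum s n fun i => c i * (w N (n i) : ℂ)
  have hqc : ∀ N k, (q N).coeff k = p.coeff k * w N k := fun N k =>
    coeff_monomialSum_mul (fun k => (w N k : ℂ)) k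
  have hbound : ∀ᶠ N in Filter.atTop, ‖p.leadingCoeff‖ * |w N p.natDegree| *
      x.re ^ p.natDegree ≤ ‖(q N).eval x‖ := by
    have hpos := (hw p.natDegree).eventually (lt_mem_nhds (Real.exp_pos _))
    have hlarge := tendsto_natCast_atTop_atTop.eventually
      (Filter.eventually_gt_atTop (t * (s.sup n : ℕ) ^ 2))
    filter_upwards [hpos, hlarge] with N h1 h2
    have hdeg : (q N).natDegree = p.natDegree := by
      refine natDegree_eq_of_le_of_coeff_ne_zero ?_ ?_
      · refine natDegree_le_iff_coeff_eq_zero.2 fun k hk => ?_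
        rw [hqc, coeff_eq_zero_of_natDegree_lt hk, zero_mul]
      · rw [hqc]
        exact mul_ne_zero (leadingCoeff_ne_zero.2 hp0) (by exact_mod_cast h1.ne')
    have := norm_leadingCoeff_mul_re_pow_le (p := q N) (fun y hy => by
      rw [eval_monomialSum]
      exact sum_mul_one_add_div_pow_ne_zero hc (fun i hi => Finset.le_sup hi) ht h2 N hy) hx
    rwa [leadingCoeff, hdeg, hqc, norm_mul, Complex.norm_real, Real.norm_eq_abs] at this
  have hlim : Filter.Tendsto (fun N => ‖(q N).eval x‖) Filter.atTop
      (nhds ‖∑ i ∈ s, c i * (Real.exp (-(t * n i ^ 2)) : ℂ) * x ^ n i‖) := by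
    simp only [q, eval_monomialSum]
    refine (tendsto_finsetSum _ fun i _ => ?_).norm
    exact (((Complex.continuous_ofReal.tendsto _).comp (hw (n i))).const_mul _).mul_const _
  have hle := le_of_tendsto_of_tendsto
    (((hw p.natDegree).abs.const_mul ‖p.leadingCoeff‖).mul_const (x.re ^ p.natDegree)) hlim hbound
  rw [← norm_pos_iff]
  refine lt_of_lt_of_le ?_ hle
  have := norm_pos_iff.2 (leadingCoeff_ne_zero.2 hp0)
  have := abs_pos.2 (Real.exp_pos (-(t * p.natDegree ^ 2))).ne'
  positivity

end GaussianMultiplier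

lemma choose_two_sub_add_choose_two {d k : ℕ} (h : k ≤ d) :
    (d - k).choose 2 + k.choose 2 + d * k = d.choose 2 + k ^ 2 := by
  obtain ⟨j, rfl⟩ := Nat.exists_eq_add_of_le h
  rw [Nat.add_sub_cancel_left]
  have : ∀ a : ℕ, (a.choose 2 : ℚ) = a * (a - 1) / 2 := fun a => Nat.cast_choose_two ℚ a
  have h2 : (((j.choose 2 + k.choose 2 + (k + j) * k : ℕ)) : ℚ) =
      (((k + j).choose 2 + k ^ 2 : ℕ) : ℚ) := by
    push_cast [this]
    ring
  exact_mod_cast h2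

lemma zpow_neg_choose_eq {b : ℝ} (hb : 1 ≤ b) {d k : ℕ} (h : k ≤ d) :
    b ^ (-(((d - k).choose 2 + k.choose 2 : ℕ) : ℤ)) =
      (b ^ d.choose 2)⁻¹ * Real.exp (-(Real.log b * k ^ 2)) * (b ^ d) ^ k := by
  have hb0 : 0 < b := by linarith
  have h1 : Real.exp (-(Real.log b * k ^ 2)) = (b ^ (k ^ 2))⁻¹ := by
    rw [Real.exp_neg, mul_comm, ← Nat.cast_pow, Real.exp_nat_mul, Real.exp_log hb0]
  rw [h1, zpow_neg, zpow_natCast, ← pow_mul, ← mul_inv, ← pow_add, inv_mul_eq_div,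
    inv_eq_one_div, div_eq_div_iff (by positivity) (by positivity), one_mul, ← pow_add,
    ← choose_two_sub_add_choose_two h]
  congr 1
  ring

/-- Weighting by `b ^ (-C(d - k, 2) - C(k, 2))` the degree `k` part preserves nonvanishing on the
open right half-plane together with the origin. -/
lemma sum_mul_zpow_choose_ne_zero {ι : Type*} {s : Finset ι} {c : ι → ℂ} {n : ι → ℕ}
    (hc : ∀ x : ℂ, 0 < x.re ∨ x = 0 → ∑ i ∈ s, c i * x ^ n i ≠ 0) {b : ℝ} (hb : 1 ≤ b) {d : ℕ}
    (hd : ∀ i ∈ s, n i ≤ d) {x : ℂ} (hx : 0 < x.re ∨ x = 0) :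
    ∑ i ∈ s, c i * ((b : ℂ) ^ (-(((d - n i).choose 2 + (n i).choose 2 : ℕ) : ℤ)) *
      x ^ n i) ≠ 0 := by
  have hb0 : 0 < b := by linarith
  have hK : (((b ^ d.choose 2)⁻¹ : ℝ) : ℂ) ≠ 0 := by
    exact_mod_cast (inv_pos.2 (pow_pos hb0 _)).ne'
  have hw : ∀ i ∈ s, (b : ℂ) ^ (-(((d - n i).choose 2 + (n i).choose 2 : ℕ) : ℤ)) =
      (((b ^ d.choose 2)⁻¹ : ℝ) : ℂ) * (Real.exp (-(Real.log b * n i ^ 2)) : ℂ) *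
        ((b ^ d : ℝ) : ℂ) ^ n i := fun i hi => by
    exact_mod_cast zpow_neg_choose_eq hb (hd i hi)
  rcases hx with hx | rfl
  · have hx' : 0 < (((b ^ d : ℝ) : ℂ) * x).re := by
      rw [Complex.re_ofReal_mul]; positivity
    have := mul_ne_zero hK (sum_mul_exp_neg_sq_ne_zero (fun y hy => hc y (.inl hy))
      (Real.log_nonneg hb) hx')
    rw [Finset.mul_sum] at this
    convert this using 1
    refine Finset.sum_congr rfl fun i hi => ?_
    rw [hw i hi]
    ring
  · have := mul_ne_zero hK (hc 0 (.inr rfl))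
    rw [Finset.mul_sum] at this
    convert this using 1
    refine Finset.sum_congr rfl fun i hi => ?_
    rw [hw i hi]
    rcases h : n i with _ | k
    · simp; ring
    · simp

section Graph

variable {V : Type*} [DecidableEq V]

lemma subDeg_le_degree [Fintype V] (G : SimpleGraph V) [DecidableRel G.Adj] {F : Finset (Sym2 V)}
    (hF : F ∈ G.edgeFinset.powerset) (v : V) : subDeg F v ≤ G.degree v := by
  rw [← G.card_incidenceFinset_eq_degree, G.incidenceFinset_eq_filter]
  exact Finset.card_le_card (Finset.filter_subset_filter _ (Finset.mem_powerset.1 hF))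

lemma sum_prod_pow_subDeg [Fintype V] (E : Finset (Sym2 V)) (x : V → ℂ) :
    ∑ F ∈ E.powerset, ∏ v, x v ^ subDeg F v = ∏ e ∈ E, (1 + ∏ v, if v ∈ e then x v else 1) := by
  rw [Finset.prod_one_add]
  refine Finset.sum_congr rfl fun F _ => ?_
  rw [Finset.prod_comm]
  refine Finset.prod_congr rfl fun v _ => ?_
  rw [← Finset.prod_filter, Finset.prod_const, subDeg]

lemma one_add_mul_ne_zero {x y : ℂ} (hx : 0 < x.re ∨ x = 0) (hy : 0 < y.re ∨ y = 0) :
    1 + x * y ≠ 0 := by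
  rcases hx with hx | rfl
  · rcases hy with hy | rfl
    · intro h
      have h1 := congrArg Complex.re h
      have h2 := congrArg Complex.im h
      simp at h1 h2
      have : y.re * Complex.normSq x + x.re = 0 := by
        rw [Complex.normSq_apply]; linear_combination x.re * h1 + x.im * h2
      have := mul_nonneg hy.le (Complex.normSq_nonneg x)
      linarith
    · simp
  · simp

lemma sum_prod_pow_subDeg_ne_zero [Fintype V] (G : SimpleGraph V) [DecidableRel G.Adj]
    {x : V → ℂ} (hx : ∀ v, 0 < (x v).re ∨ x v = 0) :
    ∑ F ∈ G.edgeFinset.powerset, ∏ v, x v ^ subDeg F v ≠ 0 := by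
  rw [sum_prod_pow_subDeg]
  refine Finset.prod_ne_zero_iff.2 fun e he => ?_
  induction e with
  | _ u w =>
    have huw : u ≠ w := G.ne_of_adj (by simpa using he)
    have : (∏ v, if v ∈ s(u, w) then x v else 1) = x u * x w := by
      rw [← Finset.prod_filter, ← Finset.prod_pair huw]
      congr 1
      ext v
      simp
    rw [this]
    exact one_add_mul_ne_zero (hx u) (hx w)

end Graph

/-- For real weights `b_v ≥ 1`, the polynomial `F_{L(G)}` is weakly Hurwitz-stable:
it does not vanish if every `λ_v` satisfies `|arg λ_v| < π/2`. -/
theorem FLG_hurwitz_stable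
    {V : Type} [Fintype V] [DecidableEq V] (G : SimpleGraph V) [DecidableRel G.Adj]
    (b : V → ℝ) (hb : ∀ v, 1 ≤ b v)
    (lam : V → ℂ) (hlam : ∀ v, |(lam v).arg| < Real.pi / 2) :
    FLG G lam (fun v => (b v : ℂ)) ≠ 0 := by
  simp only [Complex.abs_arg_lt_pi_div_two_iff] at hlam
  let w : Finset (Sym2 V) → V → ℂ := fun F v =>
    (b v : ℂ) ^ (-(((G.degree v - subDeg F v).choose 2 + (subDeg F v).choose 2 : ℕ) : ℤ))
  have key : ∀ S : Finset V, ∀ x : V → ℂ, (∀ v, 0 < (x v).re ∨ x v = 0) →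
      ∑ F ∈ G.edgeFinset.powerset,
        ∏ v, (if v ∈ S then w F v else 1) * x v ^ subDeg F v ≠ 0 := by
    intro S
    induction S using Finset.induction_on with
    | empty => intro x hx; simpa using sum_prod_pow_subDeg_ne_zero G hx
    | insert u S hu ih =>
      intro x hx
      let c : Finset (Sym2 V) → ℂ := fun F =>
        ∏ v ∈ univ.erase u, (if v ∈ S then w F v else 1) * x v ^ subDeg F v
      have hc : ∀ y : ℂ, 0 < y.re ∨ y = 0 →
          ∑ F ∈ G.edgeFinset.powerset, c F * y ^ subDeg F u ≠ 0 := by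
        intro y hy
        have := ih (Function.update x u y) fun v => by
          by_cases h : v = u
          · subst h; simpa using hy
          · simpa [h] using hx v
        convert this using 1
        refine Finset.sum_congr rfl fun F _ => ?_
        rw [← Finset.prod_erase_mul _ _ (Finset.mem_univ u)]
        simp only [hu, if_false, one_mul, Function.update_self, c]
        congr 1
        refine Finset.prod_congr rfl fun v hv => ?_
        rw [Function.update_of_ne (Finset.ne_of_mem_erase hv)]
      have := sum_mul_zpow_choose_ne_zero hc (hb u)
        (fun F hF => subDeg_le_degree G hF u) (hx u)
      convert this using 1
      refine Finset.sum_congr rfl fun F _ => ?_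
      rw [← Finset.prod_erase_mul _ _ (Finset.mem_univ u)]
      simp only [Finset.mem_insert_self, if_true, c, w]
      congr 1
      refine Finset.prod_congr rfl fun v hv => ?_
      simp [Finset.mem_insert, Finset.ne_of_mem_erase hv]
  simpa [FLG, w] using key univ lam hlam
end
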